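/- Let $H \in (0, 1/2)$ and for $T > 0$ define $K_2(T) := \int_T^{\infty} \int_0^{t/2} \int_u^{t-u} e^{-u-x} \Big( t^{2H-1} (t-x-u)^{2H-1} - (t-x)^{2H-1} (t-u)^{2H-1} \Big) dx \, du \, dt$. Then $\lim_{T \to \infty} T^{3-4H} K_2(T) = \frac{1-2H}{2(3-4H)}$. -/

import Mathlib

open MeasureTheory Real Filter

/-- Dominated convergence with an additional error term whose integral tends to zero. -/
lemma tendsto_integral_of_le_add {X ι : Type*} [MeasurableSpace X] {μ : Measure X}
    {l : Filter ι} [l.IsCountablyGenerated] {f e : ι → X → ℝ} {L b : X → ℝ}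
    (hf_meas : ∀ᶠ t in l, AEStronglyMeasurable (f t) μ)
    (hf_nonneg : ∀ᶠ t in l, ∀ᵐ x ∂μ, 0 ≤ f t x)
    (hf_le : ∀ᶠ t in l, ∀ᵐ x ∂μ, f t x ≤ b x + e t x)
    (hb : Integrable b μ) (hb_nonneg : ∀ᵐ x ∂μ, 0 ≤ b x) (hLb : ∀ᵐ x ∂μ, L x ≤ b x)
    (he : ∀ᶠ t in l, Integrable (e t) μ) (he_nonneg : ∀ᶠ t in l, ∀ᵐ x ∂μ, 0 ≤ e t x)
    (he_lim : Tendsto (fun t => ∫ x, e t x ∂μ) l (nhds 0))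
    (hf_lim : ∀ᵐ x ∂μ, Tendsto (fun t => f t x) l (nhds (L x))) :
    Tendsto (fun t => ∫ x, f t x ∂μ) l (nhds (∫ x, L x ∂μ)) := by
  have hmin_bound : ∀ᶠ t in l, ∀ᵐ x ∂μ, ‖min (f t x) (b x)‖ ≤ b x := by
    filter_upwards [hf_nonneg] with t h0
    filter_upwards [h0, hb_nonneg] with x h1 h2
    rw [Real.norm_of_nonneg (le_min h1 h2)]
    exact min_le_right _ _
  have hmin_meas : ∀ᶠ t in l, AEStronglyMeasurable (fun x => min (f t x) (b x)) μ := by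
    filter_upwards [hf_meas] with t ht using ht.inf hb.1
  have hmin : Tendsto (fun t => ∫ x, min (f t x) (b x) ∂μ) l (nhds (∫ x, L x ∂μ)) := by
    refine tendsto_integral_filter_of_dominated_convergence b hmin_meas hmin_bound hb ?_
    filter_upwards [hf_lim, hLb] with x h1 h2
    have := h1.min (tendsto_const_nhds (x := b x))
    rwa [min_eq_left h2] at this
  have hupper := hmin.add he_lim
  rw [add_zero] at hupper
  refine tendsto_of_tendsto_of_tendsto_of_le_of_le' hmin hupper ?_ ?_
  all_goals
    filter_upwards [hf_meas, hf_nonneg, hf_le, he, he_nonneg, hmin_meas, hmin_bound]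
      with t m1 n1 l1 i1 n2 m2 b2
    have hmi : Integrable (fun x => min (f t x) (b x)) μ := hb.mono' m2 b2
    have hfi : Integrable (f t) μ := by
      refine (hb.add i1).mono' m1 ?_
      filter_upwards [n1, l1] with x h1 h2
      rw [Real.norm_of_nonneg h1]
      exact h2
  · exact integral_mono hmi hfi fun x => min_le_left _ _
  · rw [← integral_add hmi i1]
    refine integral_mono_ae hfi (hmi.add i1) ?_
    filter_upwards [l1, n2] with x h1 h2
    rcases min_cases (f t x) (b x) with h | h <;> linarith [h.1]

/-- The tail integral of a function asymptotic to `c * t ^ (-(p + 1))`. -/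
lemma tendsto_rpow_mul_integral_Ioi {g : ℝ → ℝ} (hg : Measurable g) {p c : ℝ} (hp : 0 < p)
    (h : Tendsto (fun t => t ^ (p + 1) * g t) atTop (nhds c)) :
    Tendsto (fun T => T ^ p * ∫ t in Set.Ioi T, g t) atTop (nhds (c / p)) := by
  have hc : c / p = ∫ s in Set.Ioi (1 : ℝ), c * s ^ (-(p + 1)) := by
    rw [integral_const_mul, integral_Ioi_rpow_of_lt (by linarith) one_pos]
    simp only [one_rpow]
    rw [show -(p + 1) + 1 = -p by ring, neg_div_neg_eq, mul_one_div]
  have hsub : ∀ᶠ T in atTop, ∫ s in Set.Ioi (1 : ℝ), T ^ (p + 1) * g (T * s) =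
      T ^ p * ∫ t in Set.Ioi T, g t := by
    filter_upwards [eventually_gt_atTop 0] with T hT
    rw [integral_const_mul, integral_comp_mul_left_Ioi g 1 hT, mul_one, smul_eq_mul, ← mul_assoc,
      rpow_add_one hT.ne', mul_assoc (T ^ p), mul_inv_cancel₀ hT.ne', mul_one]
  have hscale : ∀ T s : ℝ, 0 < T → 1 < s →
      T ^ (p + 1) * g (T * s) = ((T * s) ^ (p + 1) * g (T * s)) * s ^ (-(p + 1)) := by
    intro T s hT hs
    have hs0 : 0 < s := by linarith
    rw [mul_rpow hT.le hs0.le, rpow_neg hs0.le]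
    have : s ^ (p + 1) ≠ 0 := (rpow_pos_of_pos hs0 _).ne'
    field_simp
  rw [hc]
  refine Tendsto.congr' hsub ?_
  have hM : ∀ᶠ t in atTop, |t ^ (p + 1) * g t| ≤ |c| + 1 :=
    (h.abs.eventually_lt_const (lt_add_one _)).mono fun t ht => ht.le
  obtain ⟨t₀, ht₀⟩ := eventually_atTop.1 hM
  refine tendsto_integral_filter_of_dominated_convergence
    (fun s => (|c| + 1) * s ^ (-(p + 1))) ?_ ?_ ?_ ?_
  · exact Eventually.of_forall fun T =>
      ((hg.comp (measurable_const_mul T)).const_mul _).aestronglyMeasurable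
  · filter_upwards [eventually_gt_atTop 0, eventually_ge_atTop t₀] with T hT hT'
    filter_upwards [ae_restrict_mem measurableSet_Ioi] with s hs
    have hs : 1 < s := hs
    rw [hscale T s hT hs, norm_mul, Real.norm_eq_abs,
      Real.norm_of_nonneg (rpow_nonneg (by linarith) _)]
    exact mul_le_mul_of_nonneg_right (ht₀ _ (by nlinarith)) (rpow_nonneg (by linarith) _)
  · exact (integrableOn_Ioi_rpow_of_lt (by linarith) one_pos).const_mul _
  · filter_upwards [ae_restrict_mem measurableSet_Ioi] with s hs
    have hs : 1 < s := hs
    have h1 : Tendsto (fun T : ℝ => T * s) atTop atTop :=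
      tendsto_id.atTop_mul_const (by linarith)
    refine ((h.comp h1).mul_const (s ^ (-(p + 1)))).congr' ?_
    filter_upwards [eventually_gt_atTop 0] with T hT
    exact (hscale T s hT hs).symm

lemma rpow_neg_sub_rpow_neg_le {a A B : ℝ} (ha : 0 ≤ a) (hA : 0 < A) (hB : 0 < B) :
    B ^ (-a) - A ^ (-a) ≤ a * (A - B) * B ^ (-(a + 1)) := by
  have h1 : A ^ (-a) = B ^ (-a) * exp (-a * log (A / B)) := by
    rw [rpow_def_of_pos hA, rpow_def_of_pos hB, ← exp_add, log_div hA.ne' hB.ne']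
    ring_nf
  have h2 : 1 - a * (A / B - 1) ≤ exp (-a * log (A / B)) := by
    have := log_le_sub_one_of_pos (div_pos hA hB)
    have := add_one_le_exp (-a * log (A / B))
    nlinarith
  have h3 : B ^ (-(a + 1)) = B ^ (-a) / B := by
    rw [neg_add', rpow_sub_one hB.ne']
  have h4 := mul_le_mul_of_nonneg_left h2 (rpow_nonneg hB.le (-a))
  rw [h1, h3]
  have h5 : a * (A - B) * (B ^ (-a) / B) = B ^ (-a) * (a * (A / B - 1)) := by
    field_simp
  linarith

lemma le_rpow_neg_sub_rpow_neg {a A B : ℝ} (ha : 0 ≤ a) (hA : 0 < A) (hB : 0 < B) :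
    a * (A - B) * A ^ (-(a + 1)) ≤ B ^ (-a) - A ^ (-a) := by
  linarith [rpow_neg_sub_rpow_neg_le ha hB hA]

/-- The integrand, cut off to the domain of integration in `u` and `x`. -/
noncomputable def kernel (a t u x : ℝ) : ℝ :=
  if 0 < u ∧ u < x ∧ x < t - u then
    exp (-u - x) * (t ^ (-a) * (t - x - u) ^ (-a) - (t - x) ^ (-a) * (t - u) ^ (-a))
  else 0

lemma measurable_kernel (a : ℝ) :
    Measurable fun p : (ℝ × ℝ) × ℝ => kernel a p.1.1 p.1.2 p.2 := by
  unfold kernel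
  refine Measurable.ite ?_ (by fun_prop) measurable_const
  have h1 : MeasurableSet {p : (ℝ × ℝ) × ℝ | 0 < p.1.2} :=
    measurableSet_lt (by fun_prop) (by fun_prop)
  have h2 : MeasurableSet {p : (ℝ × ℝ) × ℝ | p.1.2 < p.2} :=
    measurableSet_lt (by fun_prop) (by fun_prop)
  have h3 : MeasurableSet {p : (ℝ × ℝ) × ℝ | p.2 < p.1.1 - p.1.2} :=
    measurableSet_lt (by fun_prop) (by fun_prop)
  exact h1.inter (h2.inter h3)

lemma kernel_of_mem {a t u x : ℝ} (h : 0 < u ∧ u < x ∧ x < t - u) :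
    kernel a t u x =
      exp (-u - x) * ((t * (t - x - u)) ^ (-a) - ((t - x) * (t - u)) ^ (-a)) := by
  obtain ⟨h1, h2, h3⟩ := h
  rw [kernel, if_pos ⟨h1, h2, h3⟩, mul_rpow (by linarith) (by linarith),
    mul_rpow (by linarith) (by linarith)]

lemma le_kernel {a t u x : ℝ} (ha : 0 ≤ a) (h : 0 < u ∧ u < x ∧ x < t - u) :
    exp (-u - x) * (a * (u * x) * ((t - x) * (t - u)) ^ (-(a + 1))) ≤ kernel a t u x := by
  rw [kernel_of_mem h]
  have hA : 0 < (t - x) * (t - u) := mul_pos (by linarith) (by linarith)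
  have hB : 0 < t * (t - x - u) := mul_pos (by linarith) (by linarith)
  have := le_rpow_neg_sub_rpow_neg ha hA hB
  rw [show (t - x) * (t - u) - t * (t - x - u) = u * x by ring] at this
  gcongr

lemma kernel_le {a t u x : ℝ} (ha : 0 ≤ a) (h : 0 < u ∧ u < x ∧ x < t - u) :
    kernel a t u x ≤ exp (-u - x) * (a * (u * x) * (t * (t - x - u)) ^ (-(a + 1))) := by
  rw [kernel_of_mem h]
  have hA : 0 < (t - x) * (t - u) := mul_pos (by linarith) (by linarith)
  have hB : 0 < t * (t - x - u) := mul_pos (by linarith) (by linarith)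
  have := rpow_neg_sub_rpow_neg_le ha hA hB
  rw [show (t - x) * (t - u) - t * (t - x - u) = u * x by ring] at this
  gcongr

lemma kernel_nonneg {a : ℝ} (ha : 0 ≤ a) (t u x : ℝ) : 0 ≤ kernel a t u x := by
  by_cases h : 0 < u ∧ u < x ∧ x < t - u
  · refine le_trans ?_ (le_kernel ha h)
    have hA : 0 < (t - x) * (t - u) := mul_pos (by linarith) (by linarith)
    have hx : 0 < u * x := mul_pos h.1 (by linarith)
    positivity
  · rw [kernel, if_neg h]

/-- The contribution to the bound on the kernel of the region `t / 2 < u + x < t`. -/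
noncomputable def edgeBound (a t u x : ℝ) : ℝ :=
  (Set.Ioo u (t - u)).indicator (fun x => t ^ (a + 2) * exp (-(t / 2)) * (t - u - x) ^ (-a)) x

lemma edgeBound_nonneg {a t u : ℝ} (ht : 0 < t) (x : ℝ) : 0 ≤ edgeBound a t u x := by
  refine Set.indicator_nonneg (fun y hy => ?_) x
  have : 0 < t - u - y := by linarith [hy.2]
  positivity

lemma scaled_kernel_le {a t u x : ℝ} (ha : 0 ≤ a) (ht : 0 < t) (hu : 0 < u) (hx : u < x) :
    t ^ (2 * a + 2) * kernel a t u x ≤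
      a * 2 ^ (a + 1) * (u * exp (-u)) * (x * exp (-x)) + edgeBound a t u x := by
  have hx0 : 0 < x := by linarith
  have hnn : 0 ≤ a * 2 ^ (a + 1) * (u * exp (-u)) * (x * exp (-x)) := by positivity
  by_cases h : x < t - u
  swap
  · rw [kernel, if_neg (by tauto), mul_zero]
    exact add_nonneg hnn (edgeBound_nonneg ht x)
  have hs : 0 < t - x - u := by linarith
  have hexp : exp (-u - x) = exp (-u) * exp (-x) := by rw [← exp_add]; ring_nf
  rcases le_or_gt (u + x) (t / 2) with hc | hc
  · refine le_add_of_le_of_nonneg ?_ (edgeBound_nonneg ht x)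
    have h1 : t ^ (2 * a + 2) * (t * (t - x - u)) ^ (-(a + 1)) ≤ 2 ^ (a + 1) := by
      have h2 : (t * (t - x - u)) ^ (-(a + 1)) ≤ (t * (t / 2)) ^ (-(a + 1)) := by
        refine rpow_le_rpow_of_nonpos (by positivity) ?_ (by linarith)
        gcongr
        linarith
      calc t ^ (2 * a + 2) * (t * (t - x - u)) ^ (-(a + 1))
          ≤ t ^ (2 * a + 2) * (t * (t / 2)) ^ (-(a + 1)) := by gcongr
        _ = 2 ^ (a + 1) := by
          rw [show t * (t / 2) = t ^ (2 : ℝ) * 2⁻¹ by rw [rpow_two]; ring,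
            mul_rpow (by positivity) (by positivity), ← rpow_mul ht.le, ← mul_assoc,
            ← rpow_add ht, inv_rpow (by norm_num), ← rpow_neg (by norm_num)]
          ring_nf
          simp
    calc t ^ (2 * a + 2) * kernel a t u x
        ≤ t ^ (2 * a + 2) * (exp (-u - x) * (a * (u * x) * (t * (t - x - u)) ^ (-(a + 1)))) := by
          gcongr
          exact kernel_le ha ⟨hu, hx, h⟩
      _ = (a * u * x * exp (-u - x)) * (t ^ (2 * a + 2) * (t * (t - x - u)) ^ (-(a + 1))) := by
          ring
      _ ≤ (a * u * x * exp (-u - x)) * 2 ^ (a + 1) := by gcongr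
      _ = _ := by rw [hexp]; ring
  · refine le_add_of_nonneg_of_le hnn ?_
    rw [edgeBound, Set.indicator_of_mem (Set.mem_Ioo.2 ⟨hx, h⟩), kernel_of_mem ⟨hu, hx, h⟩]
    have hA : 0 < (t - x) * (t - u) := mul_pos (by linarith) (by linarith)
    have h1 : exp (-u - x) ≤ exp (-(t / 2)) := exp_le_exp.2 (by linarith)
    have h2 : 0 ≤ ((t - x) * (t - u)) ^ (-a) := rpow_nonneg hA.le _
    calc t ^ (2 * a + 2) * (exp (-u - x) *
          ((t * (t - x - u)) ^ (-a) - ((t - x) * (t - u)) ^ (-a)))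
        ≤ t ^ (2 * a + 2) * (exp (-u - x) * (t * (t - x - u)) ^ (-a)) := by
          gcongr
          linarith
      _ ≤ t ^ (2 * a + 2) * (exp (-(t / 2)) * (t * (t - x - u)) ^ (-a)) := by gcongr
      _ = t ^ (a + 2) * exp (-(t / 2)) * (t - u - x) ^ (-a) := by
          rw [mul_rpow ht.le hs.le, show t ^ (a + 2) = t ^ (2 * a + 2) * t ^ (-a) by
            rw [← rpow_add ht]; ring_nf, show t - x - u = t - u - x by ring]
          ring

lemma integrable_edgeBound {a : ℝ} (ha1 : a < 1) (t u : ℝ) : Integrable (edgeBound a t u) := by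
  refine IntegrableOn.integrable_indicator ?_ measurableSet_Ioo
  refine Integrable.const_mul ?_ _
  rcases le_or_gt u (t - u) with h | h
  · have := (intervalIntegral.intervalIntegrable_rpow' (r := -a) (a := t - u - u) (b := 0)
      (by linarith)).comp_sub_left (t - u)
    rw [sub_sub_cancel, sub_zero] at this
    exact ((intervalIntegrable_iff_integrableOn_Ioc_of_le h).1 this).mono_set
      Set.Ioo_subset_Ioc_self
  · rw [Set.Ioo_eq_empty_of_le h.le, Measure.restrict_empty]
    exact integrable_zero_measure

lemma integral_edgeBound_le {a t u : ℝ} (ha1 : a < 1) (ht : 0 < t) (hu : 0 < u) :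
    ∫ x, edgeBound a t u x ≤ t ^ 3 * exp (-(t / 2)) / (1 - a) := by
  have ha : 0 < 1 - a := by linarith
  unfold edgeBound
  rw [integral_indicator measurableSet_Ioo]
  rcases le_or_gt u (t - u) with h | h
  · rw [integral_const_mul, ← integral_Ioc_eq_integral_Ioo, ← intervalIntegral.integral_of_le h,
      intervalIntegral.integral_comp_sub_left (fun y => y ^ (-a)) (t - u), sub_self,
      integral_rpow (Or.inl (by linarith)), zero_rpow (by linarith), sub_zero,
      show -a + 1 = 1 - a by ring]
    have h1 : (t - u - u) ^ (1 - a) ≤ t ^ (1 - a) :=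
      rpow_le_rpow (by linarith) (by linarith) ha.le
    calc t ^ (a + 2) * exp (-(t / 2)) * ((t - u - u) ^ (1 - a) / (1 - a))
        ≤ t ^ (a + 2) * exp (-(t / 2)) * (t ^ (1 - a) / (1 - a)) := by gcongr
      _ = t ^ (a + 2 + (1 - a)) * exp (-(t / 2)) / (1 - a) := by rw [rpow_add ht (a + 2)]; ring
      _ = _ := by
        rw [show a + 2 + (1 - a) = ((3 : ℕ) : ℝ) by push_cast; ring, rpow_natCast]
  · rw [Set.Ioo_eq_empty_of_le h.le]
    simp only [Measure.restrict_empty, integral_zero_measure]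
    positivity

lemma hasDerivAt_neg_add_one_mul_exp_neg (x : ℝ) :
    HasDerivAt (fun y => -((y + 1) * exp (-y))) (x * exp (-x)) x := by
  convert! (((hasDerivAt_id x).add_const 1).mul (hasDerivAt_id x).neg.exp).neg using 1
  simp
  ring

lemma tendsto_neg_add_one_mul_exp_neg :
    Tendsto (fun x : ℝ => -((x + 1) * exp (-x))) atTop (nhds 0) := by
  have h1 := tendsto_pow_mul_exp_neg_atTop_nhds_zero 1
  have h0 := tendsto_pow_mul_exp_neg_atTop_nhds_zero 0
  convert! (h1.add h0).neg using 2 <;> simp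
  ring

lemma integrableOn_mul_exp_neg {u : ℝ} (hu : 0 ≤ u) :
    IntegrableOn (fun x => x * exp (-x)) (Set.Ioi u) :=
  integrableOn_Ioi_deriv_of_nonneg' (fun x _ => hasDerivAt_neg_add_one_mul_exp_neg x)
    (fun _ hx => mul_nonneg (hu.trans (le_of_lt hx)) (exp_pos _).le)
    tendsto_neg_add_one_mul_exp_neg

lemma integral_Ioi_mul_exp_neg {u : ℝ} (hu : 0 ≤ u) :
    ∫ x in Set.Ioi u, x * exp (-x) = (u + 1) * exp (-u) := by
  rw [integral_Ioi_of_hasDerivAt_of_nonneg' (fun x _ => hasDerivAt_neg_add_one_mul_exp_neg x)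
    (fun x hx => mul_nonneg (hu.trans (le_of_lt hx)) (exp_pos _).le)
    tendsto_neg_add_one_mul_exp_neg]
  ring

lemma integral_Ioi_mul_add_one_mul_exp_neg :
    ∫ u in Set.Ioi (0 : ℝ), u * exp (-u) * ((u + 1) * exp (-u)) = 1 / 2 := by
  have hd : ∀ u : ℝ, HasDerivAt (fun u => -((u ^ 2 / 2 + u + 1 / 2) * (exp (-u) * exp (-u))))
      (u * exp (-u) * ((u + 1) * exp (-u))) u := by
    intro u
    have he := (hasDerivAt_id u).neg.exp
    convert! (((((hasDerivAt_id u).pow 2).div_const 2).add (hasDerivAt_id u)).add_const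
      (1 / 2 : ℝ) |>.mul (he.mul he)).neg using 1
    simp
    ring
  have hl : Tendsto (fun u : ℝ => -((u ^ 2 / 2 + u + 1 / 2) * (exp (-u) * exp (-u)))) atTop
      (nhds 0) := by
    have h2 := tendsto_pow_mul_exp_neg_atTop_nhds_zero 2
    have h1 := tendsto_pow_mul_exp_neg_atTop_nhds_zero 1
    have h0 := tendsto_pow_mul_exp_neg_atTop_nhds_zero 0
    convert! ((((h2.div_const 2).add h1).add (h0.div_const 2)).mul h0).neg using 2
    · simp
      ring
    · simp
  rw [integral_Ioi_of_hasDerivAt_of_nonneg' (fun u _ => hd u) (fun u hu => ?_) hl]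
  · simp
  · have : (0 : ℝ) < u := hu
    positivity

lemma rpow_mul_rpow_eq_div_sq_rpow {a t B : ℝ} (ht : 0 < t) (hB : 0 < B) :
    t ^ (2 * a + 2) * B ^ (-(a + 1)) = (B / t ^ 2) ^ (-(a + 1)) := by
  rw [div_rpow hB.le (by positivity), ← rpow_two, ← rpow_mul ht.le, div_eq_mul_inv,
    ← rpow_neg ht.le, mul_comm]
  ring_nf

lemma tendsto_scaled_kernel {a u x : ℝ} (ha : 0 ≤ a) (hu : 0 < u) (hx : u < x) :
    Tendsto (fun t => t ^ (2 * a + 2) * kernel a t u x) atTop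
      (nhds (a * (u * exp (-u)) * (x * exp (-x)))) := by
  have hexp : exp (-u - x) = exp (-u) * exp (-x) := by rw [← exp_add]; ring_nf
  have hlin : ∀ c : ℝ, Tendsto (fun t : ℝ => (t - c) / t) atTop (nhds 1) := by
    intro c
    have h := (tendsto_const_nhds (x := (1 : ℝ))).sub
      ((tendsto_const_nhds (x := c)).div_atTop tendsto_id)
    rw [sub_zero] at h
    refine h.congr' ?_
    filter_upwards [eventually_gt_atTop 0] with t ht
    simp only [id]
    field_simp
  have hpow : ∀ B : ℝ → ℝ, Tendsto (fun t => B t / t ^ 2) atTop (nhds 1) →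
      Tendsto (fun t => exp (-u - x) * (a * (u * x)) * (B t / t ^ 2) ^ (-(a + 1))) atTop
        (nhds (a * (u * exp (-u)) * (x * exp (-x)))) := by
    intro B hB
    have h := (hB.rpow_const (p := -(a + 1)) (Or.inl one_ne_zero)).const_mul
      (exp (-u - x) * (a * (u * x)))
    convert! h using 2
    rw [one_rpow, hexp]
    ring
  have hA : Tendsto (fun t : ℝ => ((t - x) * (t - u)) / t ^ 2) atTop (nhds 1) := by
    have h := (hlin x).mul (hlin u)
    rw [one_mul] at h
    refine h.congr fun t => ?_
    rw [div_mul_div_comm, sq]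
  have hB : Tendsto (fun t : ℝ => (t * (t - x - u)) / t ^ 2) atTop (nhds 1) := by
    refine (hlin (x + u)).congr' ?_
    filter_upwards [eventually_gt_atTop 0] with t ht
    field_simp
    ring
  refine tendsto_of_tendsto_of_tendsto_of_le_of_le' (hpow _ hA) (hpow _ hB) ?_ ?_
  · filter_upwards [eventually_gt_atTop (x + u)] with t ht
    rw [← rpow_mul_rpow_eq_div_sq_rpow (by linarith) (mul_pos (by linarith) (by linarith))]
    have := mul_le_mul_of_nonneg_left (le_kernel (t := t) ha ⟨hu, hx, by linarith⟩)
      (rpow_nonneg (show 0 ≤ t by linarith) (2 * a + 2))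
    linarith
  · filter_upwards [eventually_gt_atTop (x + u)] with t ht
    rw [← rpow_mul_rpow_eq_div_sq_rpow (by linarith) (mul_pos (by linarith) (by linarith))]
    have := mul_le_mul_of_nonneg_left (kernel_le (t := t) ha ⟨hu, hx, by linarith⟩)
      (rpow_nonneg (show 0 ≤ t by linarith) (2 * a + 2))
    linarith

lemma integral_kernel_eq_setIntegral (a t u : ℝ) :
    ∫ x, kernel a t u x = ∫ x in Set.Ioi u, kernel a t u x := by
  refine (setIntegral_eq_integral_of_forall_compl_eq_zero fun x hx => ?_).symm
  exact if_neg fun h => hx h.2.1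

lemma integral_kernel_eq_zero {a t u : ℝ} (h : u ≤ 0 ∨ t / 2 ≤ u) :
    ∫ x, kernel a t u x = 0 := by
  refine integral_eq_zero_of_ae (ae_of_all _ fun x => if_neg ?_)
  rintro ⟨h1, h2, h3⟩
  rcases h with h | h <;> linarith

lemma measurable_kernel_right (a t u : ℝ) : Measurable (kernel a t u) :=
  (measurable_kernel a).comp (measurable_prodMk_left (x := ((t, u) : ℝ × ℝ)))

lemma stronglyMeasurable_integral_kernel (a : ℝ) :
    StronglyMeasurable fun p : ℝ × ℝ => ∫ x, kernel a p.1 p.2 x :=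
  (measurable_kernel a).stronglyMeasurable.integral_prod_right'

lemma setIntegral_edgeBound_le {a t u : ℝ} (ha1 : a < 1) (ht : 0 < t)
    (hu : 0 < u) :
    ∫ x in Set.Ioi u, edgeBound a t u x ≤ t ^ 3 * exp (-(t / 2)) / (1 - a) :=
  (setIntegral_le_integral (integrable_edgeBound ha1 t u)
    (ae_of_all _ fun x => edgeBound_nonneg ht x)).trans (integral_edgeBound_le ha1 ht hu)

lemma tendsto_scaled_integral_kernel {a u : ℝ} (ha0 : 0 ≤ a) (ha1 : a < 1) (hu : 0 < u) :
    Tendsto (fun t => t ^ (2 * a + 2) * ∫ x, kernel a t u x) atTop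
      (nhds (a * (u * exp (-u) * ((u + 1) * exp (-u))))) := by
  rw [← integral_Ioi_mul_exp_neg hu.le, ← mul_assoc, ← integral_const_mul]
  simp_rw [integral_kernel_eq_setIntegral, ← integral_const_mul]
  have hmem : ∀ᵐ x ∂volume.restrict (Set.Ioi u), u < x := ae_restrict_mem measurableSet_Ioi
  refine tendsto_integral_of_le_add (b := fun x => a * 2 ^ (a + 1) * (u * exp (-u)) *
    (x * exp (-x))) (e := fun t x => edgeBound a t u x) ?_ ?_ ?_ ?_ ?_ ?_ ?_ ?_ ?_ ?_
  · exact Eventually.of_forall fun t =>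
      ((measurable_kernel_right a t u).const_mul _).aestronglyMeasurable
  · filter_upwards [eventually_gt_atTop 0] with t ht
    exact ae_of_all _ fun x => mul_nonneg (rpow_nonneg ht.le _) (kernel_nonneg ha0 t u x)
  · filter_upwards [eventually_gt_atTop 0] with t ht
    filter_upwards [hmem] with x hx using scaled_kernel_le ha0 ht hu hx
  · exact (integrableOn_mul_exp_neg hu.le).const_mul _
  · filter_upwards [hmem] with x hx
    have : 0 < x := hu.trans hx
    positivity
  · filter_upwards [hmem] with x hx
    have : 0 < x := hu.trans hx
    have h2 : (1 : ℝ) ≤ 2 ^ (a + 1) := one_le_rpow (by norm_num) (by linarith)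
    gcongr
    exact le_mul_of_one_le_right ha0 h2
  · exact Eventually.of_forall fun t => (integrable_edgeBound ha1 t u).integrableOn
  · filter_upwards [eventually_gt_atTop 0] with t ht
    exact ae_of_all _ fun x => edgeBound_nonneg ht x
  · have hlim : Tendsto (fun t : ℝ => t ^ 3 * exp (-(t / 2)) / (1 - a)) atTop (nhds 0) := by
      have h := (tendsto_rpow_mul_exp_neg_mul_atTop_nhds_zero 3 (1 / 2) (by norm_num)).div_const
        (1 - a)
      rw [zero_div] at h
      refine h.congr fun t => ?_
      rw [show (3 : ℝ) = ((3 : ℕ) : ℝ) by norm_num, rpow_natCast]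
      ring_nf
    refine tendsto_of_tendsto_of_tendsto_of_le_of_le' tendsto_const_nhds hlim ?_ ?_
    · filter_upwards [eventually_gt_atTop 0] with t ht
      exact integral_nonneg fun x => edgeBound_nonneg ht x
    · filter_upwards [eventually_gt_atTop 0] with t ht
      exact setIntegral_edgeBound_le ha1 ht hu
  · filter_upwards [hmem] with x hx using tendsto_scaled_kernel ha0 hu hx

lemma scaled_integral_kernel_le {a t u : ℝ} (ha0 : 0 ≤ a) (ha1 : a < 1) (ht : 0 < t)
    (hu : 0 < u) :
    t ^ (2 * a + 2) * ∫ x, kernel a t u x ≤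
      a * 2 ^ (a + 1) * (u * exp (-u)) + 384 / (1 - a) * exp (-(1 / 2) * u) := by
  have ha : 0 < 1 - a := by linarith
  rcases le_or_gt (t / 2) u with h | h
  · rw [integral_kernel_eq_zero (Or.inr h), mul_zero]
    positivity
  rw [integral_kernel_eq_setIntegral, ← integral_const_mul]
  have hi := (integrableOn_mul_exp_neg hu.le).const_mul (a * 2 ^ (a + 1) * (u * exp (-u)))
  have he : IntegrableOn (edgeBound a t u) (Set.Ioi u) :=
    (integrable_edgeBound ha1 t u).integrableOn
  have h1 : ∫ x in Set.Ioi u, t ^ (2 * a + 2) * kernel a t u x ≤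
      ∫ x in Set.Ioi u, (a * 2 ^ (a + 1) * (u * exp (-u)) * (x * exp (-x)) +
        edgeBound a t u x) := by
    refine integral_mono_of_nonneg
      (ae_of_all _ fun x => mul_nonneg (rpow_nonneg ht.le _) (kernel_nonneg ha0 t u x))
      (hi.add he) ?_
    filter_upwards [ae_restrict_mem measurableSet_Ioi] with x hx
    exact scaled_kernel_le ha0 ht hu hx
  rw [integral_add hi he, integral_const_mul (a * 2 ^ (a + 1) * (u * exp (-u))),
    integral_Ioi_mul_exp_neg hu.le] at h1
  have h2 := setIntegral_edgeBound_le ha1 ht hu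
  have h3 : (u + 1) * exp (-u) ≤ 1 := by
    rw [exp_neg, ← div_eq_mul_inv, div_le_one (exp_pos u)]
    exact add_one_le_exp u
  have h4 : t ^ 3 * exp (-(t / 2)) ≤ 384 * exp (-(1 / 2) * u) := by
    have h5 : t ^ 3 ≤ 384 * exp (t / 4) := by
      have := pow_div_factorial_le_exp (t / 4) (by positivity) 3
      norm_num [Nat.factorial] at this
      linarith
    calc t ^ 3 * exp (-(t / 2)) ≤ 384 * exp (t / 4) * exp (-(t / 2)) := by gcongr
      _ = 384 * exp (t / 4 + -(t / 2)) := by rw [exp_add]; ring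
      _ ≤ 384 * exp (-(1 / 2) * u) := by
        gcongr
        linarith
  refine h1.trans (add_le_add ?_ (h2.trans ?_))
  · exact mul_le_of_le_one_right (by positivity) h3
  · rw [div_mul_eq_mul_div]
    gcongr

lemma tendsto_scaled_integral_integral_kernel {a : ℝ} (ha0 : 0 ≤ a) (ha1 : a < 1) :
    Tendsto (fun t => t ^ (2 * a + 2) * ∫ u, ∫ x, kernel a t u x) atTop (nhds (a / 2)) := by
  have ha : 0 < 1 - a := by linarith
  have hset : ∀ t, ∫ u, ∫ x, kernel a t u x = ∫ u in Set.Ioi 0, ∫ x, kernel a t u x := by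
    intro t
    refine (setIntegral_eq_integral_of_forall_compl_eq_zero fun u hu => ?_).symm
    exact integral_kernel_eq_zero (Or.inl (not_lt.1 hu))
  have hval : a / 2 = ∫ u in Set.Ioi (0 : ℝ), a * (u * exp (-u) * ((u + 1) * exp (-u))) := by
    rw [integral_const_mul, integral_Ioi_mul_add_one_mul_exp_neg]
    ring
  have hmem : ∀ᵐ u ∂volume.restrict (Set.Ioi (0 : ℝ)), 0 < u := ae_restrict_mem measurableSet_Ioi
  rw [hval]
  simp_rw [hset]
  refine Tendsto.congr (fun t => integral_const_mul (t ^ (2 * a + 2)) _) ?_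
  refine tendsto_integral_filter_of_dominated_convergence (fun u =>
    a * 2 ^ (a + 1) * (u * exp (-u)) + 384 / (1 - a) * exp (-(1 / 2) * u)) ?_ ?_ ?_ ?_
  · refine Eventually.of_forall fun t => ?_
    exact (((stronglyMeasurable_integral_kernel a).comp_measurable
      (measurable_prodMk_left (x := t))).const_mul _).aestronglyMeasurable
  · filter_upwards [eventually_gt_atTop 0] with t ht
    filter_upwards [hmem] with u hu
    rw [Real.norm_of_nonneg
      (mul_nonneg (rpow_nonneg ht.le _) (integral_nonneg fun x => kernel_nonneg ha0 t u x))]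
    exact scaled_integral_kernel_le ha0 ha1 ht hu
  · exact ((integrableOn_mul_exp_neg le_rfl).const_mul _).add
      ((exp_neg_integrableOn_Ioi 0 (by norm_num)).const_mul _)
  · filter_upwards [hmem] with u hu using tendsto_scaled_integral_kernel ha0 ha1 hu

lemma intervalIntegral_eq_integral_kernel (a : ℝ) {t : ℝ} (ht : 0 < t) :
    (∫ u in (0 : ℝ)..(t / 2), ∫ x in u..(t - u), exp (-u - x) *
      (t ^ (-a) * (t - x - u) ^ (-a) - (t - x) ^ (-a) * (t - u) ^ (-a))) =
    ∫ u, ∫ x, kernel a t u x := by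
  have hset : ∫ u, ∫ x, kernel a t u x = ∫ u in Set.Ioc 0 (t / 2), ∫ x, kernel a t u x := by
    refine (setIntegral_eq_integral_of_forall_compl_eq_zero fun u hu => ?_).symm
    refine integral_kernel_eq_zero ?_
    by_contra! h
    exact hu ⟨h.1, h.2.le⟩
  rw [hset, intervalIntegral.integral_of_le (by positivity)]
  refine setIntegral_congr_fun measurableSet_Ioc fun u hu => ?_
  have hle : u ≤ t - u := by linarith [hu.2]
  rw [intervalIntegral.integral_of_le hle, integral_Ioc_eq_integral_Ioo,
    ← integral_indicator measurableSet_Ioo]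
  congr 1 with x
  rw [kernel, Set.indicator_apply]
  simp only [hu.1, true_and, Set.mem_Ioo]

theorem stmt_18 (H : ℝ) (hH : H ∈ Set.Ioo (0:ℝ) (1/2))
    (K2 : ℝ → ℝ)
    (hK2 : ∀ T : ℝ, K2 T =
      ∫ t in Set.Ioi T, ∫ u in (0:ℝ)..(t / 2), ∫ x in u..(t - u),
        Real.exp (-u - x) * (t ^ (2 * H - 1) * (t - x - u) ^ (2 * H - 1) -
          (t - x) ^ (2 * H - 1) * (t - u) ^ (2 * H - 1))) :
    Tendsto (fun T : ℝ => T ^ (3 - 4 * H) * K2 T) atTop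
      (nhds ((1 - 2 * H) / (2 * (3 - 4 * H)))) := by
  obtain ⟨hH0, hH1⟩ := hH
  have hmeas : Measurable fun t => ∫ u, ∫ x, kernel (1 - 2 * H) t u x :=
    (stronglyMeasurable_integral_kernel (1 - 2 * H)).integral_prod_right'.measurable
  have hlim := tendsto_scaled_integral_integral_kernel (a := 1 - 2 * H)
    (by linarith) (by linarith)
  rw [show 2 * (1 - 2 * H) + 2 = 3 - 4 * H + 1 by ring] at hlim
  have hmain := tendsto_rpow_mul_integral_Ioi hmeas (by linarith) hlim
  rw [div_div] at hmain
  refine hmain.congr' ?_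
  filter_upwards [eventually_ge_atTop 0] with T hT
  rw [hK2, show 2 * H - 1 = -(1 - 2 * H) by ring]
  congr 1
  refine setIntegral_congr_fun measurableSet_Ioi fun t ht => ?_
  exact (intervalIntegral_eq_integral_kernel (1 - 2 * H) (lt_of_le_of_lt hT ht)).symm
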